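/- For an augmented unital associative dg algebra A over R, multiplications on the unnormalized bar construction BA correspond bijectively to twisting cochains: every multiplication f : BA⊗BA → BA that is a morphism of dg coalgebras with the counit element 1 as two-sided unit is uniquely determined by E = α∘f, and E then satisfies d(E) = E∪E and E(1,−) = E(−,1) = α; conversely, every degree-1 map E : BA⊗BA → A with d(E) = E∪E and E(1,−) = E(−,1) = α arises in this way from a unique such multiplication f. -/

import Mathlib

open scoped TensorProduct

noncomputable section

/-- The sign `(-1)^n` as an integer, for `n : ℤ`. -/
def pm (n : ℤ) : ℤ := (((-1 : ℤˣ) ^ n : ℤˣ) : ℤ)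

/-- The total desuspended degree `Σᵢ (nᵢ - 1)` of a list of (cohomological) degrees;
this is the degree of the bar word `[a₁|⋯|a_k]` when `aᵢ` has degree `nᵢ`. -/
def bdeg (ds : List ℤ) : ℤ := (ds.map (fun n => n - 1)).sum

/-- An augmented, unital, associative differential graded algebra over a commutative
unital ring `R`, with cohomological grading (the differential has degree `+1`).
The grading is internal (`grading_internal`), multiplication and unit are graded,
the differential satisfies the graded Leibniz rule, and the augmentation is a
map of augmented dg algebras.  The operator `sgn` is the canonical "sign" operator
multiplying the component of degree `i` by `(-1)^i`; it is uniquely determined by the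
grading and is included as data for convenience (Koszul signs). -/
structure DGAlgebra (R : Type) [CommRing R] : Type 1 where
  carrier : Type
  [ring : Ring carrier]
  [alg : Algebra R carrier]
  grading : ℤ → Submodule R carrier
  grading_internal : DirectSum.IsInternal grading
  one_mem : (1 : carrier) ∈ grading 0
  mul_mem : ∀ {i j : ℤ} {a b : carrier},
    a ∈ grading i → b ∈ grading j → (a * b) ∈ grading (i + j)
  d : carrier →ₗ[R] carrier
  d_mem : ∀ {i : ℤ} {a : carrier}, a ∈ grading i → d a ∈ grading (i + 1)
  d_sq : ∀ a, d (d a) = 0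
  leibniz : ∀ {i : ℤ} {a b : carrier}, a ∈ grading i →
    d (a * b) = d a * b + pm i • (a * d b)
  aug : carrier →ₐ[R] R
  aug_d : ∀ a, aug (d a) = 0
  aug_graded : ∀ {i : ℤ} {a : carrier}, a ∈ grading i → i ≠ 0 → aug a = 0
  sgn : carrier →ₗ[R] carrier
  sgn_apply : ∀ {i : ℤ} {a : carrier}, a ∈ grading i → sgn a = pm i • a

attribute [instance] DGAlgebra.ring DGAlgebra.alg

namespace DGAlgebra

variable {R : Type} [CommRing R] (A : DGAlgebra R)

/-- The unnormalized bar construction `BA = T(s⁻¹A)` of `A`, *as a graded `R`-module*.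
At the level of (ungraded) `R`-modules it is the tensor algebra on the underlying
module of `A`; the word `[a₁|⋯|a_k]` is the product `ι a₁ ⋯ ι a_k`.  The
(de)suspension is invisible at the module level; it is accounted for by the degree
conventions (`bdeg`) and the sign operators. -/
abbrev Bar : Type := TensorAlgebra R A.carrier

/-- The bar word `[a₁|⋯|a_k] ∈ BA`. The empty word is the counit element `𝟙`. -/
def word (l : List A.carrier) : A.Bar := (l.map (TensorAlgebra.ι R)).prod

/-- `A.Homog l ds` says that the list `l` consists of homogeneous elements,
`l i` having degree `ds i`. -/
def Homog (l : List A.carrier) (ds : List ℤ) : Prop :=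
  l.length = ds.length ∧ ∀ i : ℕ, l.getD i 0 ∈ A.grading (ds.getD i 0)

/-- The concatenation operator `∇ : BA ⊗ BA → BA`. -/
def concat : A.Bar ⊗[R] A.Bar →ₗ[R] A.Bar := LinearMap.mul' R A.Bar

/-- The augmentation ideal `Ā ⊆ A`. -/
def augIdeal : Submodule R A.carrier := LinearMap.ker A.aug.toLinearMap

/-- The normalized bar construction `B̄A = T(s⁻¹Ā)`. -/
abbrev NBar : Type := TensorAlgebra R A.augIdeal

/-- words in the normalized bar construction. -/
def nword (l : List A.augIdeal) : A.NBar := (l.map (TensorAlgebra.ι R)).prod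

/-- The canonical inclusion `B̄A → BA`. -/
def nincl : A.NBar →ₗ[R] A.Bar :=
  (TensorAlgebra.lift R ((TensorAlgebra.ι R) ∘ₗ A.augIdeal.subtype)).toLinearMap

/-- The (internal, total-degree) grading of the bar construction:
`(BA)_n` is spanned by the homogeneous words of total desuspended degree `n`. -/
def barGrading (n : ℤ) : Submodule R A.Bar :=
  Submodule.span R {x | ∃ l ds, A.Homog l ds ∧ bdeg ds = n ∧ x = A.word l}

end DGAlgebra

/-- All the canonical structure carried by the bar construction `BA` of an augmented
dg algebra `A`: the deconcatenation coproduct `Δ`, the bar differential `dB`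
(tensor-product differential plus the `∂` multiplying adjacent entries through the
desuspended multiplication), the sign operator `sgnB`, the graded twist `tw`, the
canonical twisting cochain `α` (projection to `B₁A = s⁻¹A` followed by `σ`), and the
counit `εB`.  Each operator is uniquely determined by its prescribed values on the
words `[a₁|⋯|a_k]`, which span `BA`. -/
structure BarData {R : Type} [CommRing R] (A : DGAlgebra R) : Type where
  /-- deconcatenation coproduct -/
  Δ : A.Bar →ₗ[R] A.Bar ⊗[R] A.Bar
  Δ_word : ∀ l : List A.carrier,
    Δ (A.word l) = ∑ i ∈ Finset.range (l.length + 1),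
      A.word (l.take i) ⊗ₜ[R] A.word (l.drop i)
  /-- the bar differential -/
  dB : A.Bar →ₗ[R] A.Bar
  dB_word : ∀ (l : List A.carrier) (ds : List ℤ), A.Homog l ds →
    dB (A.word l) =
      - (∑ i ∈ Finset.range l.length,
          pm (bdeg (ds.take i)) • A.word (l.set i (A.d (l.getD i 0))))
      + ∑ i ∈ Finset.range (l.length - 1),
          pm (bdeg (ds.take (i + 1))) •
            A.word (l.take i ++ (l.getD i 0 * l.getD (i + 1) 0) :: l.drop (i + 2))
  /-- the sign operator of `BA` -/
  sgnB : A.Bar →ₗ[R] A.Bar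
  sgnB_word : ∀ (l : List A.carrier) (ds : List ℤ), A.Homog l ds →
    sgnB (A.word l) = pm (bdeg ds) • A.word l
  /-- the graded (Koszul) twist `BA ⊗ BA → BA ⊗ BA` -/
  tw : A.Bar ⊗[R] A.Bar →ₗ[R] A.Bar ⊗[R] A.Bar
  tw_word : ∀ (l m : List A.carrier) (ds es : List ℤ), A.Homog l ds → A.Homog m es →
    tw (A.word l ⊗ₜ[R] A.word m) = pm (bdeg ds * bdeg es) • (A.word m ⊗ₜ[R] A.word l)
  /-- the canonical twisting cochain `α : BA → A` -/
  α : A.Bar →ₗ[R] A.carrier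
  α_single : ∀ a : A.carrier, α (A.word [a]) = a
  α_word : ∀ l : List A.carrier, l.length ≠ 1 → α (A.word l) = 0
  /-- the counit of `BA` -/
  εB : A.Bar →ₗ[R] R
  εB_one : εB (1 : A.Bar) = 1
  εB_word : ∀ l : List A.carrier, l ≠ [] → εB (A.word l) = 0

namespace BarData

variable {R : Type} [CommRing R] {A : DGAlgebra R} (BD : BarData A)

/-- `sgnB` raised to the power `n` (only the parity of `n` matters);
used to express Koszul signs `(-1)^{n·|x|}`. -/
def sgnPow (n : ℤ) : A.Bar →ₗ[R] A.Bar :=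
  if n % 2 = 0 then LinearMap.id else BD.sgnB

/-- The differential of `BA ⊗ BA` (with the Koszul sign rule). -/
def dBB : A.Bar ⊗[R] A.Bar →ₗ[R] A.Bar ⊗[R] A.Bar :=
  TensorProduct.map BD.dB LinearMap.id + TensorProduct.map BD.sgnB BD.dB

/-- The middle interchange `1 ⊗ tw ⊗ 1` on `(BA ⊗ BA) ⊗ (BA ⊗ BA)`
(the graded twist of the two middle factors). -/
def midTw : (A.Bar ⊗[R] A.Bar) ⊗[R] (A.Bar ⊗[R] A.Bar) →ₗ[R]
    (A.Bar ⊗[R] A.Bar) ⊗[R] (A.Bar ⊗[R] A.Bar) :=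
  let e₁ := TensorProduct.assoc R A.Bar A.Bar (A.Bar ⊗[R] A.Bar)
  let e₂ := TensorProduct.congr (LinearEquiv.refl R A.Bar)
    (TensorProduct.assoc R A.Bar A.Bar A.Bar).symm
  e₁.symm.toLinearMap ∘ₗ e₂.symm.toLinearMap ∘ₗ
    (TensorProduct.map LinearMap.id (TensorProduct.map BD.tw LinearMap.id)) ∘ₗ
    e₂.toLinearMap ∘ₗ e₁.toLinearMap

/-- The coproduct of `BA ⊗ BA` (with Koszul signs). -/
def ΔBB : A.Bar ⊗[R] A.Bar →ₗ[R] (A.Bar ⊗[R] A.Bar) ⊗[R] (A.Bar ⊗[R] A.Bar) :=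
  BD.midTw ∘ₗ TensorProduct.map BD.Δ BD.Δ

/-- The counit of `BA ⊗ BA`. -/
def εBB : A.Bar ⊗[R] A.Bar →ₗ[R] R :=
  (TensorProduct.lid R R).toLinearMap ∘ₗ TensorProduct.map BD.εB BD.εB

/-- The twisting cochain `β = ε_{BA} ⊗ α : BA ⊗ BA → A`. -/
def β : A.Bar ⊗[R] A.Bar →ₗ[R] A.carrier :=
  (TensorProduct.lid R A.carrier).toLinearMap ∘ₗ TensorProduct.map BD.εB BD.α

end BarData

/-- `E : BA ⊗ BA → A` is a twisting cochain: it has degree `+1`, satisfies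
`E(𝟙,-) = E(-,𝟙) = α` and the twisting cochain equation `d(E) = E ∪ E`,
written as `d∘E + E∘d_{BA⊗BA} = μ_A (E ⊗ E) Δ_{BA⊗BA}` (all Koszul signs being
expressed via the sign operators). -/
structure IsTwistingCochain {R : Type} [CommRing R] {A : DGAlgebra R} (BD : BarData A)
    (E : A.Bar ⊗[R] A.Bar →ₗ[R] A.carrier) : Prop where
  degree : ∀ (l m : List A.carrier) (ds es : List ℤ), A.Homog l ds → A.Homog m es →
    E (A.word l ⊗ₜ[R] A.word m) ∈ A.grading (bdeg ds + bdeg es + 1)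
  unit_left : ∀ b : A.Bar, E ((1 : A.Bar) ⊗ₜ[R] b) = BD.α b
  unit_right : ∀ a : A.Bar, E (a ⊗ₜ[R] (1 : A.Bar)) = BD.α a
  twist : A.d ∘ₗ E + E ∘ₗ BD.dBB =
    LinearMap.mul' R A.carrier ∘ₗ
      TensorProduct.map (E ∘ₗ TensorProduct.map BD.sgnB BD.sgnB) E ∘ₗ BD.ΔBB

/-- A twisting cochain is *normalized* if `E([1],𝟙) = E(𝟙,[1]) = 1`, if `E(a,b) = 0`
whenever the total bar length is `> 1` and some entry equals `1 ∈ A`, and if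
`E(a,b)` lies in the augmentation ideal whenever the total bar length is `> 1`. -/
structure IsNormalized {R : Type} [CommRing R] {A : DGAlgebra R}
    (E : A.Bar ⊗[R] A.Bar →ₗ[R] A.carrier) : Prop where
  one_right : E (A.word [(1 : A.carrier)] ⊗ₜ[R] (1 : A.Bar)) = 1
  one_left : E ((1 : A.Bar) ⊗ₜ[R] A.word [(1 : A.carrier)]) = 1
  vanish : ∀ l m : List A.carrier, 1 < l.length + m.length →
    ((1 : A.carrier) ∈ l ∨ (1 : A.carrier) ∈ m) → E (A.word l ⊗ₜ[R] A.word m) = 0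
  aug_ideal : ∀ l m : List A.carrier, 1 < l.length + m.length →
    A.aug (E (A.word l ⊗ₜ[R] A.word m)) = 0

/-- A twisting cochain has *level 3* if `E(a,b) = 0` whenever `a` has bar length `> 1`. -/
def IsLevel3 {R : Type} [CommRing R] {A : DGAlgebra R}
    (E : A.Bar ⊗[R] A.Bar →ₗ[R] A.carrier) : Prop :=
  ∀ (l m : List A.carrier), 1 < l.length → E (A.word l ⊗ₜ[R] A.word m) = 0

/-- A multiplication on the unnormalized bar construction `BA`: a morphism of
dg coalgebras `BA ⊗ BA → BA` of degree `0` having the counit element `𝟙` as a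
two-sided unit (associativity is *not* required). -/
structure BarMult {R : Type} [CommRing R] {A : DGAlgebra R} (BD : BarData A) : Type where
  f : A.Bar ⊗[R] A.Bar →ₗ[R] A.Bar
  one_mul : ∀ b : A.Bar, f ((1 : A.Bar) ⊗ₜ[R] b) = b
  mul_one : ∀ a : A.Bar, f (a ⊗ₜ[R] (1 : A.Bar)) = a
  graded : ∀ (l m : List A.carrier) (ds es : List ℤ), A.Homog l ds → A.Homog m es →
    f (A.word l ⊗ₜ[R] A.word m) ∈ A.barGrading (bdeg ds + bdeg es)
  chain : BD.dB ∘ₗ f = f ∘ₗ BD.dBB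
  counit : BD.εB ∘ₗ f = BD.εBB
  coalg : BD.Δ ∘ₗ f = TensorProduct.map f f ∘ₗ BD.ΔBB



section Helpers

theorem pm_add (a b : ℤ) : pm (a + b) = pm a * pm b := by
  simp [pm, zpow_add]

theorem pm_zero : pm 0 = 1 := by simp [pm]

theorem pm_one : pm 1 = -1 := by simp [pm]

theorem pm_self (a : ℤ) : pm a * pm a = 1 := by
  rw [← pm_add, ← two_mul]; simp [pm, zpow_mul]

theorem pm_neg (a : ℤ) : pm (-a) = pm a := by
  have h := pm_self a
  have h2 : pm (-a) * pm a = 1 := by rw [← pm_add]; simp [pm_zero]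
  calc pm (-a) = pm (-a) * (pm a * pm a) := by rw [h, mul_one]
    _ = pm a := by rw [← mul_assoc, h2, one_mul]

theorem pm_sub (a b : ℤ) : pm (a - b) = pm a * pm b := by
  rw [sub_eq_add_neg, pm_add, pm_neg]

/-- Sum over all ways to split a list in two consecutive pieces. -/
def spl {X N : Type} [AddCommGroup N] : List X → (List X → List X → N) → N
  | [], g => g [] []
  | a :: L, g => g [] (a :: L) + spl L (fun Y Z => g (a :: Y) Z)

section spl
variable {X N P : Type} [AddCommGroup N] [AddCommGroup P]

theorem spl_eq_sum (L : List X) (g : List X → List X → N) :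
    spl L g = ∑ i ∈ Finset.range (L.length + 1), g (L.take i) (L.drop i) := by
  induction L generalizing g with
  | nil => simp [spl]
  | cons a L ih =>
    rw [spl, ih, List.length_cons, Finset.sum_range_succ' _ (L.length + 1), add_comm]
    simp

theorem spl_congr {L : List X} {g g' : List X → List X → N}
    (h : ∀ Y Z, Y ++ Z = L → g Y Z = g' Y Z) : spl L g = spl L g' := by
  rw [spl_eq_sum, spl_eq_sum]
  exact Finset.sum_congr rfl fun i _ => h _ _ (List.take_append_drop i L)

theorem spl_add (L : List X) (g g' : List X → List X → N) :
    spl L (fun Y Z => g Y Z + g' Y Z) = spl L g + spl L g' := by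
  simp [spl_eq_sum, Finset.sum_add_distrib]

theorem spl_zero (L : List X) : spl L (fun _ _ => (0 : N)) = 0 := by
  simp [spl_eq_sum]

theorem map_spl (φ : N →+ P) (L : List X) (g : List X → List X → N) :
    φ (spl L g) = spl L (fun Y Z => φ (g Y Z)) := by
  simp [spl_eq_sum]

theorem smul_spl (c : ℤ) (L : List X) (g : List X → List X → N) :
    c • (spl L g) = spl L (fun Y Z => c • (g Y Z)) := by
  simp [spl_eq_sum, Finset.smul_sum]

theorem spl_comm {X' : Type} (L : List X) (M : List X')
    (g : List X → List X → List X' → List X' → N) :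
    spl L (fun Y Z => spl M (fun U V => g Y Z U V)) =
    spl M (fun U V => spl L (fun Y Z => g Y Z U V)) := by
  simp only [spl_eq_sum]; exact Finset.sum_comm

theorem spl_coassoc (L : List X) (g : List X → List X → List X → N) :
    spl L (fun Y Z => spl Y (fun U V => g U V Z)) =
    spl L (fun U Y => spl Y (fun V Z => g U V Z)) := by
  induction L generalizing g with
  | nil => simp [spl]
  | cons a L ih =>
    simp only [spl]
    rw [spl_add, ih (fun U V Z => g (a :: U) V Z)]
    abel

theorem spl_left (L : List X) (g : List X → List X → N)
    (h : ∀ Y Z, Y ≠ [] → g Y Z = 0) : spl L g = g [] L := by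
  cases L with
  | nil => rfl
  | cons a L =>
    rw [spl]
    have : (fun Y Z => g (a :: Y) Z) = fun _ _ => (0 : N) := by
      funext Y Z; exact h _ _ (by simp)
    rw [this, spl_zero, add_zero]

theorem spl_right (L : List X) (g : List X → List X → N)
    (h : ∀ Y Z, Z ≠ [] → g Y Z = 0) : spl L g = g L [] := by
  induction L generalizing g with
  | nil => rfl
  | cons a L ih =>
    rw [spl, h _ _ (by simp), zero_add, ih]
    exact fun Y Z hZ => h _ _ hZ

end spl

variable {R : Type} [CommRing R] {A : DGAlgebra R}

/-- homogeneous letters -/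
abbrev HL (A : DGAlgebra R) : Type := Σ n : ℤ, A.grading n

/-- the word on homogeneous letters -/
def hw (L : List (HL A)) : A.Bar := A.word (L.map (fun x => (x.2 : A.carrier)))

/-- degree of a homogeneous word -/
def hd (L : List (HL A)) : ℤ := bdeg (L.map (fun x => x.1))

/-- the tensor product of two words -/
def hc (L M : List (HL A)) : A.Bar ⊗[R] A.Bar := hw L ⊗ₜ[R] hw M

theorem bdeg_nil : bdeg [] = 0 := by simp [bdeg]
theorem bdeg_cons (n : ℤ) (l : List ℤ) : bdeg (n :: l) = (n - 1) + bdeg l := by simp [bdeg]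

theorem hw_nil : hw ([] : List (HL A)) = 1 := by simp [hw, DGAlgebra.word]
theorem hw_cons (a : HL A) (L : List (HL A)) :
    hw (a :: L) = TensorAlgebra.ι R (a.2 : A.carrier) * hw L := by
  simp [hw, DGAlgebra.word]
theorem hw_append (L M : List (HL A)) : hw (L ++ M) = hw L * hw M := by
  simp [hw, DGAlgebra.word]
theorem hd_nil : hd ([] : List (HL A)) = 0 := by simp [hd, bdeg]
theorem hd_cons (a : HL A) (L : List (HL A)) : hd (a :: L) = a.1 - 1 + hd L := by
  simp [hd, bdeg]
theorem hd_append (L M : List (HL A)) : hd (L ++ M) = hd L + hd M := by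
  simp [hd, bdeg]

theorem homog_cons {a : A.carrier} {l : List A.carrier} {n : ℤ} {ds : List ℤ} :
    A.Homog (a :: l) (n :: ds) ↔ a ∈ A.grading n ∧ A.Homog l ds := by
  constructor
  · rintro ⟨h1, h2⟩
    refine ⟨by simpa using h2 0, by simpa using h1, fun i => by simpa using h2 (i + 1)⟩
  · rintro ⟨h0, h1, h2⟩
    refine ⟨by simpa using h1, fun i => ?_⟩
    cases i with
    | zero => simpa using h0
    | succ i => simpa using h2 i

theorem homog_nil : A.Homog [] [] := ⟨rfl, fun i => by simp⟩

theorem homog_hw (L : List (HL A)) :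
    A.Homog (L.map (fun x => (x.2 : A.carrier))) (L.map (fun x => x.1)) := by
  induction L with
  | nil => exact homog_nil
  | cons a L ih => exact homog_cons.2 ⟨a.2.2, ih⟩

theorem homog_exists {l : List A.carrier} {ds : List ℤ} (h : A.Homog l ds) :
    ∃ L : List (HL A), L.map (fun x => (x.2 : A.carrier)) = l ∧ L.map (fun x => x.1) = ds := by
  induction l generalizing ds with
  | nil =>
    have := h.1
    cases ds with
    | nil => exact ⟨[], rfl, rfl⟩
    | cons => simp at this
  | cons a l ih =>
    cases ds with
    | nil => have := h.1; simp at this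
    | cons n ds =>
      obtain ⟨h0, h1⟩ := homog_cons.1 h
      obtain ⟨L, rfl, rfl⟩ := ih h1
      exact ⟨⟨n, a, h0⟩ :: L, rfl, rfl⟩

theorem hw_span : Submodule.span R (Set.range (hw : List (HL A) → A.Bar)) = ⊤ := by
  rw [eq_top_iff]
  intro x _
  induction x using TensorAlgebra.induction with
  | algebraMap r =>
    rw [Algebra.algebraMap_eq_smul_one]
    exact Submodule.smul_mem _ _ (Submodule.subset_span ⟨[], hw_nil⟩)
  | ι a =>
    have ha : a ∈ iSup A.grading := by
      rw [A.grading_internal.submodule_iSup_eq_top]; trivial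
    induction ha using Submodule.iSup_induction' with
    | mem i y hy =>
      refine Submodule.subset_span ⟨[⟨i, y, hy⟩], ?_⟩
      rw [hw_cons, hw_nil, mul_one]
    | zero => simp
    | add y z _ _ hy hz => rw [map_add]; exact Submodule.add_mem _ (hy trivial) (hz trivial)
  | mul a b ha hb =>
    have ha := ha trivial
    have hb := hb trivial
    have := Submodule.mul_mem_mul ha hb
    rw [Submodule.span_mul_span] at this
    refine Submodule.span_mono ?_ this
    rintro _ ⟨_, ⟨L, rfl⟩, _, ⟨M, rfl⟩, rfl⟩
    exact ⟨L ++ M, hw_append L M⟩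
  | add a b ha hb => exact Submodule.add_mem _ (ha trivial) (hb trivial)

theorem bar_ext {N : Type} [AddCommMonoid N] [Module R N] {f g : A.Bar →ₗ[R] N}
    (h : ∀ L, f (hw L) = g (hw L)) : f = g := by
  refine LinearMap.ext_on hw_span ?_
  rintro _ ⟨L, rfl⟩
  exact h L

theorem bb_ext {N : Type} [AddCommMonoid N] [Module R N] {f g : A.Bar ⊗[R] A.Bar →ₗ[R] N}
    (h : ∀ L M, f (hc L M) = g (hc L M)) : f = g := by
  apply TensorProduct.ext
  apply bar_ext
  intro L
  apply bar_ext
  intro M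
  exact h L M

theorem bbbb_ext {N : Type} [AddCommMonoid N] [Module R N]
    {f g : (A.Bar ⊗[R] A.Bar) ⊗[R] (A.Bar ⊗[R] A.Bar) →ₗ[R] N}
    (h : ∀ L M U V, f (hc L M ⊗ₜ[R] hc U V) = g (hc L M ⊗ₜ[R] hc U V)) : f = g := by
  apply TensorProduct.ext
  apply bb_ext
  intro L M
  apply bb_ext
  intro U V
  exact h L M U V

theorem barGrading_eq (n : ℤ) :
    A.barGrading n = Submodule.span R {x | ∃ L : List (HL A), hd L = n ∧ x = hw L} := by
  unfold DGAlgebra.barGrading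
  congr 1
  ext x
  constructor
  · rintro ⟨l, ds, h, h1, h2⟩
    obtain ⟨L, rfl, rfl⟩ := homog_exists h
    exact ⟨L, h1, h2⟩
  · rintro ⟨L, h1, h2⟩
    exact ⟨_, _, homog_hw L, h1, h2⟩

theorem hw_mem (L : List (HL A)) : hw L ∈ A.barGrading (hd L) := by
  rw [barGrading_eq]; exact Submodule.subset_span ⟨L, rfl, rfl⟩

theorem barGrading_induction {n : ℤ} {p : A.Bar → Prop} (h0 : p 0)
    (hadd : ∀ x y, p x → p y → p (x + y)) (hsmul : ∀ (r : R) x, p x → p (r • x))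
    (h : ∀ L : List (HL A), hd L = n → p (hw L)) {x : A.Bar} (hx : x ∈ A.barGrading n) : p x := by
  rw [barGrading_eq] at hx
  induction hx using Submodule.span_induction with
  | mem x hx => obtain ⟨L, h1, rfl⟩ := hx; exact h L h1
  | zero => exact h0
  | add x y _ _ hx hy => exact hadd _ _ hx hy
  | smul r x _ hx => exact hsmul _ _ hx

theorem ι_mul_mem {a : A.carrier} {i n : ℤ} (ha : a ∈ A.grading i) {x : A.Bar}
    (hx : x ∈ A.barGrading n) : TensorAlgebra.ι R a * x ∈ A.barGrading (i - 1 + n) := by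
  refine barGrading_induction (p := fun x => TensorAlgebra.ι R a * x ∈ A.barGrading (i - 1 + n))
    ?_ ?_ ?_ ?_ hx
  · simp
  · intro x y hx hy; rw [mul_add]; exact Submodule.add_mem _ hx hy
  · intro r x hx; rw [mul_smul_comm]; exact Submodule.smul_mem _ _ hx
  · rintro L rfl
    have := hw_mem (⟨i, a, ha⟩ :: L : List (HL A))
    rwa [hw_cons, hd_cons] at this

theorem word_cons (a : A.carrier) (l : List A.carrier) :
    A.word (a :: l) = TensorAlgebra.ι R a * A.word l := by
  simp [DGAlgebra.word]

variable (BD : BarData A)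

theorem Δ_hw (L : List (HL A)) :
    BD.Δ (hw L) = spl L (fun X Y => hw X ⊗ₜ[R] hw Y) := by
  rw [spl_eq_sum, hw, BD.Δ_word]
  simp [hw]

theorem Δ_one : BD.Δ 1 = 1 ⊗ₜ[R] 1 := by
  rw [← hw_nil, Δ_hw]; rfl

theorem Δ_cons (a : A.carrier) (x : A.Bar) :
    BD.Δ (TensorAlgebra.ι R a * x) = 1 ⊗ₜ[R] (TensorAlgebra.ι R a * x) +
      TensorProduct.map (LinearMap.mulLeft R (TensorAlgebra.ι R a)) LinearMap.id (BD.Δ x) := by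
  have hx : x ∈ Submodule.span R (Set.range (hw : List (HL A) → A.Bar)) := by
    rw [hw_span]; trivial
  induction hx using Submodule.span_induction with
  | mem x hx =>
    obtain ⟨L, rfl⟩ := hx
    rw [hw, ← word_cons, BD.Δ_word, BD.Δ_word, List.length_cons, Finset.sum_range_succ', add_comm]
    simp [word_cons]
    simp [DGAlgebra.word]
  | zero => simp
  | add x y _ _ hx hy => 
    rw [mul_add, map_add, hx, hy, map_add, map_add, TensorProduct.tmul_add]; abel
  | smul r x _ hx =>
    rw [mul_smul_comm, map_smul, hx, map_smul, map_smul, TensorProduct.tmul_smul, smul_add]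

theorem εB_cons (a : A.carrier) (x : A.Bar) : BD.εB (TensorAlgebra.ι R a * x) = 0 := by
  have : BD.εB ∘ₗ LinearMap.mulLeft R (TensorAlgebra.ι R a) = 0 := by
    apply bar_ext
    intro L
    simp only [LinearMap.comp_apply, LinearMap.mulLeft_apply, LinearMap.zero_apply]
    rw [hw, ← word_cons]
    exact BD.εB_word _ (by simp)
  exact LinearMap.congr_fun this x

theorem α_one : BD.α 1 = 0 := by
  have := BD.α_word [] (by simp)
  simpa [DGAlgebra.word] using this

theorem α_cons (a : A.carrier) (x : A.Bar) :
    BD.α (TensorAlgebra.ι R a * x) = BD.εB x • a := by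
  have : BD.α ∘ₗ LinearMap.mulLeft R (TensorAlgebra.ι R a) =
      (LinearMap.toSpanSingleton R A.carrier a) ∘ₗ BD.εB := by
    apply bar_ext
    intro L
    simp only [LinearMap.comp_apply, LinearMap.mulLeft_apply, LinearMap.toSpanSingleton_apply]
    cases L with
    | nil =>
      rw [hw_nil, BD.εB_one, one_smul, mul_one]
      simpa [DGAlgebra.word] using BD.α_single a
    | cons b L =>
      rw [hw_cons, εB_cons, zero_smul, ← hw_cons, hw, ← word_cons]
      exact BD.α_word _ (by simp)
  exact LinearMap.congr_fun this x

theorem εB_hw_ne {L : List (HL A)} (h : L ≠ []) : BD.εB (hw L) = 0 := by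
  cases L with
  | nil => exact absurd rfl h
  | cons a L => rw [hw_cons, εB_cons]

theorem bar_decomp (x : A.Bar) : x = BD.εB x • (1 : A.Bar) +
    (LinearMap.mul' R A.Bar ∘ₗ TensorProduct.map (TensorAlgebra.ι R ∘ₗ BD.α) LinearMap.id ∘ₗ BD.Δ) x
    := by
  have : LinearMap.id = (LinearMap.toSpanSingleton R A.Bar 1) ∘ₗ BD.εB +
    (LinearMap.mul' R A.Bar ∘ₗ TensorProduct.map (TensorAlgebra.ι R ∘ₗ BD.α) LinearMap.id ∘ₗ BD.Δ)
      := by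
    apply bar_ext
    intro L
    cases L with
    | nil => simp [hw_nil, Δ_one, α_one, BD.εB_one]
    | cons a L =>
      simp only [LinearMap.id_apply, LinearMap.add_apply, LinearMap.comp_apply]
      rw [Δ_hw, spl, hw_nil]
      simp only [map_add, TensorProduct.map_tmul, LinearMap.comp_apply, α_one, map_zero,
        TensorProduct.zero_tmul, zero_add]
      rw [hw_cons, εB_cons, map_zero, zero_add]
      have := map_spl (LinearMap.mul' R A.Bar ∘ₗ TensorProduct.map (TensorAlgebra.ι R ∘ₗ BD.α)
        LinearMap.id).toAddMonoidHom L (fun Y Z => hw (a :: Y) ⊗ₜ[R] hw Z)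
      simp only [LinearMap.toAddMonoidHom_coe, LinearMap.comp_apply] at this
      rw [this, spl_left]
      · simp [hw_cons, hw_nil]
        have := α_cons BD (a.2 : A.carrier) 1
        rw [mul_one, BD.εB_one, one_smul] at this
        rw [this]
      · intro Y Z hY
        simp [hw_cons, α_cons, εB_hw_ne BD hY]
  exact LinearMap.congr_fun this x

/-- `[b|...] ↦ [ab|...]` -/
def Mop (a : A.carrier) : A.Bar →ₗ[R] A.Bar :=
  LinearMap.mul' R A.Bar ∘ₗ
    TensorProduct.map (TensorAlgebra.ι R ∘ₗ LinearMap.mulLeft R a ∘ₗ BD.α) LinearMap.id ∘ₗ BD.Δ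

theorem Mop_one (a : A.carrier) : Mop BD a 1 = 0 := by
  simp [Mop, Δ_one, α_one]

theorem Mop_cons (a b : A.carrier) (x : A.Bar) :
    Mop BD a (TensorAlgebra.ι R b * x) = TensorAlgebra.ι R (a * b) * x := by
  have : Mop BD a ∘ₗ LinearMap.mulLeft R (TensorAlgebra.ι R b) =
      LinearMap.mulLeft R (TensorAlgebra.ι R (a * b)) := by
    apply bar_ext
    intro L
    simp only [LinearMap.comp_apply, LinearMap.mulLeft_apply, Mop]
    rw [Δ_cons, Δ_hw]
    simp only [map_add, TensorProduct.map_tmul, LinearMap.comp_apply, α_one, map_zero,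
        TensorProduct.zero_tmul, zero_add]
    have := map_spl (LinearMap.mul' R A.Bar ∘ₗ
      TensorProduct.map (TensorAlgebra.ι R ∘ₗ LinearMap.mulLeft R a ∘ₗ BD.α) LinearMap.id ∘ₗ
      TensorProduct.map (LinearMap.mulLeft R (TensorAlgebra.ι R b)) LinearMap.id).toAddMonoidHom L
       (fun Y Z => hw Y ⊗ₜ[R] hw Z)
    simp only [LinearMap.toAddMonoidHom_coe, LinearMap.comp_apply] at this
    rw [this, spl_left]
    · simp [hw_nil]
      have := α_cons BD b 1
      rw [mul_one, BD.εB_one, one_smul] at this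
      rw [this]
    · intro Y Z hY
      simp [α_cons, εB_hw_ne BD hY]
  exact LinearMap.congr_fun this x

theorem dB_one : BD.dB 1 = 0 := by
  have := BD.dB_word [] [] homog_nil
  simpa [DGAlgebra.word] using this

theorem dB_cons {a : A.carrier} {n : ℤ} (ha : a ∈ A.grading n) (x : A.Bar) :
    BD.dB (TensorAlgebra.ι R a * x) = - (TensorAlgebra.ι R (A.d a) * x)
      + pm (n - 1) • (TensorAlgebra.ι R a * BD.dB x) + pm (n - 1) • Mop BD a x := by
  have : BD.dB ∘ₗ LinearMap.mulLeft R (TensorAlgebra.ι R a) =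
      - LinearMap.mulLeft R (TensorAlgebra.ι R (A.d a))
      + pm (n - 1) • (LinearMap.mulLeft R (TensorAlgebra.ι R a) ∘ₗ BD.dB) + pm (n - 1) • Mop BD a := by
    apply bar_ext
    intro L
    simp only [LinearMap.comp_apply, LinearMap.mulLeft_apply, LinearMap.add_apply,
      LinearMap.neg_apply, LinearMap.smul_apply]
    cases L with
    | nil =>
      have := BD.dB_word [a] [n] (homog_cons.2 ⟨ha, homog_nil⟩)
      simp [hw_nil, dB_one, Mop_one]
      simpa [DGAlgebra.word, bdeg_nil, pm_zero] using this
    | cons b L =>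
      rw [hw_cons b L, Mop_cons, ← hw_cons b L]
      have h := homog_hw (b :: L)
      rw [hw, ← word_cons, BD.dB_word _ _ (homog_cons.2 ⟨ha, h⟩), BD.dB_word _ _ h]
      simp only [List.map_cons]
      have e0 : hw L = A.word (L.map fun x => (x.2 : A.carrier)) := rfl
      rw [e0]
      generalize (L.map fun x => (x.2 : A.carrier)) = l
      generalize (L.map fun x => x.1) = ds
      have e1 : (a :: (b.2 : A.carrier) :: l).length = ((b.2 : A.carrier) :: l).length + 1 := rfl
      have e2 : (a :: (b.2 : A.carrier) :: l).length - 1 = l.length + 1 := by simp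
      have e3 : ((b.2 : A.carrier) :: l).length - 1 = l.length := by simp
      rw [e2, e3, e1, Finset.sum_range_succ', Finset.sum_range_succ' _ l.length]
      simp only [List.take_succ_cons, List.set_cons_succ, List.getD_cons_succ, List.take_zero,
        List.set_cons_zero, List.getD_cons_zero, bdeg_nil, bdeg_cons, pm_zero, one_smul, word_cons,
        List.drop_succ_cons, List.cons_append, List.nil_append, List.drop_zero, pm_add, mul_smul,
        mul_add, mul_neg, Finset.mul_sum, smul_add, smul_neg, Finset.smul_sum, mul_smul_comm]
      have key : ∀ a b c e : A.Bar, -(a + b) + (c + e) = -b + (-a + c) + e := by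
        intros; abel
      exact key _ _ _ _
  exact LinearMap.congr_fun this x

theorem Mop_mem {a : A.carrier} {i n : ℤ} (ha : a ∈ A.grading i) {x : A.Bar}
    (hx : x ∈ A.barGrading n) : Mop BD a x ∈ A.barGrading (i + n) := by
  refine barGrading_induction (p := fun x => Mop BD a x ∈ A.barGrading (i + n))
    ?_ ?_ ?_ ?_ hx
  · simp
  · intro x y hx hy; rw [map_add]; exact Submodule.add_mem _ hx hy
  · intro r x hx; rw [map_smul]; exact Submodule.smul_mem _ _ hx
  · rintro L rfl
    cases L with
    | nil => simp [hw_nil, Mop_one]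
    | cons b L =>
      rw [hw_cons, Mop_cons, hd_cons]
      have := ι_mul_mem (A.mul_mem ha b.2.2) (hw_mem L)
      convert this using 2
      ring

theorem dB_hw_mem (L : List (HL A)) : BD.dB (hw L) ∈ A.barGrading (hd L + 1) := by
  induction L with
  | nil => simp [hw_nil, dB_one]
  | cons a L ih =>
    rw [hw_cons, dB_cons BD a.2.2, hd_cons]
    refine Submodule.add_mem _ (Submodule.add_mem _ (Submodule.neg_mem _ ?_) ?_) ?_
    · convert ι_mul_mem (A.d_mem a.2.2) (hw_mem L) using 2
      ring
    · refine zsmul_mem ?_ _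
      convert ι_mul_mem a.2.2 ih using 2
      ring
    · refine zsmul_mem ?_ _
      convert Mop_mem BD a.2.2 (hw_mem L) using 2
      ring

theorem sgnB_mem {n : ℤ} {x : A.Bar} (hx : x ∈ A.barGrading n) : BD.sgnB x = pm n • x := by
  refine barGrading_induction (p := fun x => BD.sgnB x = pm n • x)
    ?_ ?_ ?_ ?_ hx
  · simp
  · intro x y hx hy; rw [map_add, hx, hy, smul_add]
  · intro r x hx; rw [map_smul, hx, smul_comm]
  · rintro L rfl
    exact BD.sgnB_word _ _ (homog_hw L)

theorem sgnB_hw (L : List (HL A)) : BD.sgnB (hw L) = pm (hd L) • hw L :=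
  sgnB_mem BD (hw_mem L)

theorem tw_mem {p q : ℤ} {x y : A.Bar} (hx : x ∈ A.barGrading p) (hy : y ∈ A.barGrading q) :
    BD.tw (x ⊗ₜ[R] y) = pm (p * q) • (y ⊗ₜ[R] x) := by
  refine barGrading_induction (p := fun x => BD.tw (x ⊗ₜ[R] y) = pm (p * q) • (y ⊗ₜ[R] x))
    ?_ ?_ ?_ ?_ hx
  · simp
  · intro x x' hx hx'
    rw [TensorProduct.add_tmul, map_add, hx, hx', TensorProduct.tmul_add, smul_add]
  · intro r x hx
    rw [← TensorProduct.smul_tmul', map_smul, hx, TensorProduct.tmul_smul, smul_comm]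
  · rintro L rfl
    refine barGrading_induction
      (p := fun y => BD.tw (hw L ⊗ₜ[R] y) = pm (hd L * q) • (y ⊗ₜ[R] hw L)) ?_ ?_ ?_ ?_ hy
    · simp
    · intro x x' hx hx'
      rw [TensorProduct.tmul_add, map_add, hx, hx', TensorProduct.add_tmul, smul_add]
    · intro r x hx
      rw [← TensorProduct.smul_tmul', TensorProduct.tmul_smul, map_smul, hx, smul_comm]
    · rintro M rfl
      exact BD.tw_word _ _ _ _ (homog_hw L) (homog_hw M)

theorem midTw_mem {p q : ℤ} (w : A.Bar) {x y : A.Bar} (z : A.Bar)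
    (hx : x ∈ A.barGrading p) (hy : y ∈ A.barGrading q) :
    BD.midTw ((w ⊗ₜ[R] x) ⊗ₜ[R] (y ⊗ₜ[R] z)) =
      pm (p * q) • ((w ⊗ₜ[R] y) ⊗ₜ[R] (x ⊗ₜ[R] z)) := by
  have e : (pm (p * q) • (y ⊗ₜ[R] x)) = ((pm (p * q) • y) ⊗ₜ[R] x) := by
    rw [TensorProduct.smul_tmul']
  have e2 : pm (p * q) • ((w ⊗ₜ[R] y) ⊗ₜ[R] (x ⊗ₜ[R] z)) =
      ((w ⊗ₜ[R] (pm (p * q) • y)) ⊗ₜ[R] (x ⊗ₜ[R] z)) := by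
    rw [TensorProduct.tmul_smul, TensorProduct.smul_tmul']
  rw [e2]
  simp [BarData.midTw, tw_mem BD hx hy, e]

/-- signed sum over pairs of splittings -/
def bispl {N : Type} [AddCommGroup N] (L M : List (HL A))
    (g : List (HL A) → List (HL A) → List (HL A) → List (HL A) → N) : N :=
  spl L fun X Y => spl M fun U V => pm (hd Y * hd U) • g X U Y V

section bispl
variable {N P : Type} [AddCommGroup N] [AddCommGroup P]

theorem bispl_congr {L M : List (HL A)}
    {g g' : List (HL A) → List (HL A) → List (HL A) → List (HL A) → N}
    (h : ∀ X U Y V, X ++ Y = L → U ++ V = M → g X U Y V = g' X U Y V) :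
    bispl L M g = bispl L M g' :=
  spl_congr fun X Y h1 => spl_congr fun U V h2 => by rw [h X U Y V h1 h2]

theorem bispl_add (L M : List (HL A))
    (g g' : List (HL A) → List (HL A) → List (HL A) → List (HL A) → N) :
    bispl L M (fun X U Y V => g X U Y V + g' X U Y V) = bispl L M g + bispl L M g' := by
  simp only [bispl, smul_add, spl_add]

theorem bispl_zero (L M : List (HL A)) :
    bispl L M (fun _ _ _ _ => (0 : N)) = 0 := by
  simp only [bispl, smul_zero, spl_zero]

theorem map_bispl (φ : N →+ P) (L M : List (HL A))
    (g : List (HL A) → List (HL A) → List (HL A) → List (HL A) → N) :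
    φ (bispl L M g) = bispl L M (fun X U Y V => φ (g X U Y V)) := by
  simp only [bispl, map_spl, map_zsmul]

theorem lmap_bispl [Module R N] [Module R P] (φ : N →ₗ[R] P) (L M : List (HL A))
    (g : List (HL A) → List (HL A) → List (HL A) → List (HL A) → N) :
    φ (bispl L M g) = bispl L M (fun X U Y V => φ (g X U Y V)) :=
  map_bispl φ.toAddMonoidHom L M g

theorem lmap_spl [Module R N] [Module R P] (φ : N →ₗ[R] P) (L : List (HL A))
    (g : List (HL A) → List (HL A) → N) :
    φ (spl L g) = spl L (fun X Y => φ (g X Y)) :=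
  map_spl φ.toAddMonoidHom L g

theorem bispl_coassoc (L M : List (HL A))
    (g : List (HL A) → List (HL A) → List (HL A) → List (HL A) →
      List (HL A) → List (HL A) → N) :
    bispl L M (fun X U Y V => bispl X U (fun X1 U1 X2 U2 => g X1 U1 X2 U2 Y V)) =
    bispl L M (fun X U Y V => bispl Y V (fun Y1 V1 Y2 V2 => g X U Y1 V1 Y2 V2)) := by
  have h1 : bispl L M (fun X U Y V => bispl X U (fun X1 U1 X2 U2 => g X1 U1 X2 U2 Y V)) =
    spl L (fun X Y => spl X (fun X1 X2 => spl M (fun U V => spl U (fun U1 U2 =>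
      pm (hd Y * (hd U1 + hd U2) + hd X2 * hd U1) • g X1 U1 X2 U2 Y V)))) := by
    refine spl_congr fun X Y _ => ?_
    rw [spl_comm]
    refine spl_congr fun U V _ => ?_
    dsimp only [bispl]
    rw [smul_spl]
    refine spl_congr fun X1 X2 _ => ?_
    rw [smul_spl]
    refine spl_congr fun U1 U2 h => ?_
    rw [smul_smul, ← pm_add, ← h, hd_append]
  have h2 : bispl L M (fun X U Y V => bispl Y V (fun Y1 V1 Y2 V2 => g X U Y1 V1 Y2 V2)) =
    spl L (fun X Y => spl Y (fun Y1 Y2 => spl M (fun U V => spl V (fun V1 V2 =>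
      pm ((hd Y1 + hd Y2) * hd U + hd Y2 * hd V1) • g X U Y1 V1 Y2 V2)))) := by
    refine spl_congr fun X Y _ => ?_
    rw [spl_comm]
    refine spl_congr fun U V _ => ?_
    dsimp only [bispl]
    rw [smul_spl]
    refine spl_congr fun X1 X2 h => ?_
    rw [smul_spl]
    refine spl_congr fun U1 U2 _ => ?_
    rw [smul_smul, ← pm_add, ← h, hd_append]
  rw [h1, h2, spl_coassoc L (fun X1 X2 Y => spl M (fun U V => spl U (fun U1 U2 =>
      pm (hd Y * (hd U1 + hd U2) + hd X2 * hd U1) • g X1 U1 X2 U2 Y V)))]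
  refine spl_congr fun X Y _ => spl_congr fun Y1 Y2 _ => ?_
  rw [spl_coassoc M (fun U1 U2 V =>
    pm (hd Y2 * (hd U1 + hd U2) + hd Y1 * hd U1) • g X U1 Y1 U2 Y2 V)]
  refine spl_congr fun X Y _ => spl_congr fun Y1 Y2 _ => ?_
  congr 2
  ring

theorem bispl_left (L M : List (HL A))
    (g : List (HL A) → List (HL A) → List (HL A) → List (HL A) → N)
    (h : ∀ X U Y V, X ≠ [] ∨ U ≠ [] → g X U Y V = 0) : bispl L M g = g [] [] L M := by
  unfold bispl
  rw [spl_left, spl_left]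
  · simp [hd_nil, pm_zero]
  · intro Y Z hY; rw [h _ _ _ _ (Or.inr hY), smul_zero]
  · intro Y Z hY
    rw [← spl_zero M]
    exact spl_congr fun U V _ => by rw [h _ _ _ _ (Or.inl hY), smul_zero]

theorem bispl_right (L M : List (HL A))
    (g : List (HL A) → List (HL A) → List (HL A) → List (HL A) → N)
    (h : ∀ X U Y V, Y ≠ [] ∨ V ≠ [] → g X U Y V = 0) : bispl L M g = g L M [] [] := by
  unfold bispl
  rw [spl_right, spl_right]
  · simp [hd_nil, pm_zero]
  · intro Y Z hY; rw [h _ _ _ _ (Or.inr hY), smul_zero]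
  · intro Y Z hY
    rw [← spl_zero M]
    exact spl_congr fun U V _ => by rw [h _ _ _ _ (Or.inl hY), smul_zero]

end bispl

theorem ΔBB_hc (L M : List (HL A)) :
    BD.ΔBB (hc L M) = bispl L M (fun X U Y V => hc X U ⊗ₜ[R] hc Y V) := by
  rw [BarData.ΔBB, LinearMap.comp_apply, hc, TensorProduct.map_tmul, Δ_hw, Δ_hw]
  have h1 := lmap_spl (N := A.Bar ⊗[R] A.Bar) (P := (A.Bar ⊗[R] A.Bar) ⊗[R] (A.Bar ⊗[R] A.Bar)) (BD.midTw ∘ₗ (TensorProduct.mk R (A.Bar ⊗[R] A.Bar) (A.Bar ⊗[R] A.Bar)).flip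
    (spl M fun X Y => hw X ⊗ₜ[R] hw Y)) L fun X Y => hw X ⊗ₜ[R] hw Y
  simp only [LinearMap.comp_apply, LinearMap.flip_apply, TensorProduct.mk_apply] at h1
  rw [h1]
  refine spl_congr fun X Y _ => ?_
  have h2 := lmap_spl (N := A.Bar ⊗[R] A.Bar) (P := (A.Bar ⊗[R] A.Bar) ⊗[R] (A.Bar ⊗[R] A.Bar)) (BD.midTw ∘ₗ (TensorProduct.mk R (A.Bar ⊗[R] A.Bar) (A.Bar ⊗[R] A.Bar))
    (hw X ⊗ₜ[R] hw Y)) M fun X Y => hw X ⊗ₜ[R] hw Y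
  simp only [LinearMap.comp_apply, TensorProduct.mk_apply] at h2
  rw [h2]
  refine spl_congr fun U V _ => ?_
  rw [midTw_mem BD _ _ (hw_mem Y) (hw_mem U)]
  rfl

theorem Δ_Mop (a : A.carrier) (x : A.Bar) :
    BD.Δ (Mop BD a x) = TensorProduct.map (Mop BD a) LinearMap.id (BD.Δ x) +
      1 ⊗ₜ[R] Mop BD a x := by
  have : BD.Δ ∘ₗ Mop BD a = TensorProduct.map (Mop BD a) LinearMap.id ∘ₗ BD.Δ +
      TensorProduct.mk R A.Bar A.Bar 1 ∘ₗ Mop BD a := by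
    apply bar_ext
    intro L
    simp only [LinearMap.comp_apply, LinearMap.add_apply, TensorProduct.mk_apply]
    cases L with
    | nil => simp [hw_nil, Mop_one, Δ_one]
    | cons b L =>
      rw [hw_cons, Mop_cons, Δ_cons, Δ_cons, map_add, TensorProduct.map_tmul, Mop_one,
        TensorProduct.zero_tmul, zero_add, add_comm]
      congr 1
      generalize BD.Δ (hw L) = y
      rw [← LinearMap.comp_apply (TensorProduct.map (Mop BD a) LinearMap.id),
        ← TensorProduct.map_comp]
      congr 2
      exact LinearMap.ext fun x => (Mop_cons BD a b.2 x).symm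
  exact LinearMap.congr_fun this x

theorem dB_coder : BD.Δ ∘ₗ BD.dB =
    (TensorProduct.map BD.dB LinearMap.id + TensorProduct.map BD.sgnB BD.dB) ∘ₗ BD.Δ := by
  apply bar_ext
  intro L
  induction L with
  | nil => simp [hw_nil, dB_one, Δ_one]
  | cons a L ih =>
    simp only [LinearMap.comp_apply, LinearMap.add_apply] at ih ⊢
    have hs1 : BD.sgnB 1 = 1 := by
      have := sgnB_hw BD []
      rwa [hw_nil, hd_nil, pm_zero, one_smul] at this
    have hs : BD.sgnB ∘ₗ LinearMap.mulLeft R (TensorAlgebra.ι R (a.2 : A.carrier)) =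
        pm (a.1 - 1) • (LinearMap.mulLeft R (TensorAlgebra.ι R (a.2 : A.carrier)) ∘ₗ BD.sgnB) := by
      apply bar_ext
      intro M
      have := sgnB_hw BD (a :: M)
      rw [hw_cons, hd_cons] at this
      simp only [LinearMap.comp_apply, LinearMap.mulLeft_apply, LinearMap.smul_apply]
      rw [this, sgnB_hw, mul_smul_comm, smul_smul, pm_add]
    have hd : BD.dB ∘ₗ LinearMap.mulLeft R (TensorAlgebra.ι R (a.2 : A.carrier)) =
      - LinearMap.mulLeft R (TensorAlgebra.ι R (A.d a.2))
      + pm (a.1 - 1) • (LinearMap.mulLeft R (TensorAlgebra.ι R (a.2 : A.carrier)) ∘ₗ BD.dB)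
      + pm (a.1 - 1) • Mop BD a.2 := LinearMap.ext fun x => dB_cons BD a.2.2 x
    have m1 : ∀ (f g : A.Bar →ₗ[R] A.Bar) (y : A.Bar ⊗[R] A.Bar), TensorProduct.map f g
      (TensorProduct.map (LinearMap.mulLeft R (TensorAlgebra.ι R (a.2 : A.carrier))) LinearMap.id y)
      = TensorProduct.map (f ∘ₗ LinearMap.mulLeft R (TensorAlgebra.ι R (a.2 : A.carrier))) g y := by
      intro f g y
      rw [← LinearMap.comp_apply, ← TensorProduct.map_comp, LinearMap.comp_id]
    have m2 : ∀ (f g : A.Bar →ₗ[R] A.Bar) (n : ℤ),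
      TensorProduct.map (n • f) g = n • TensorProduct.map f g := by
      intro f g n
      apply TensorProduct.ext'
      intro x y
      simp [TensorProduct.smul_tmul']
    have m3 : ∀ (f g : A.Bar →ₗ[R] A.Bar),
      TensorProduct.map (-f) g = - TensorProduct.map f g := by
      intro f g
      apply TensorProduct.ext'
      intro x y
      simp [TensorProduct.neg_tmul]
    have m4 : ∀ (f g : A.Bar →ₗ[R] A.Bar) (y : A.Bar ⊗[R] A.Bar),
      TensorProduct.map (LinearMap.mulLeft R (TensorAlgebra.ι R (a.2 : A.carrier)) ∘ₗ f) g y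
      = TensorProduct.map (LinearMap.mulLeft R (TensorAlgebra.ι R (a.2 : A.carrier))) LinearMap.id
        (TensorProduct.map f g y) := by
      intro f g y
      rw [← LinearMap.comp_apply, ← TensorProduct.map_comp, LinearMap.id_comp]
    rw [hw_cons, Δ_cons, map_add, map_add, m1, m1, hs, hd, TensorProduct.map_add_left,
      TensorProduct.map_add_left, m2, m2, m2, m3]
    simp only [LinearMap.add_apply, LinearMap.smul_apply, LinearMap.neg_apply, m4,
      TensorProduct.map_tmul, hs1, dB_one, TensorProduct.zero_tmul]
    rw [dB_cons BD a.2.2]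
    simp only [map_add, map_neg, map_zsmul, Δ_cons, Δ_Mop, ih, TensorProduct.tmul_add,
      TensorProduct.tmul_neg, TensorProduct.tmul_smul, smul_add, zero_add]
    abel

theorem sgn_Δ : BD.Δ ∘ₗ BD.sgnB = TensorProduct.map BD.sgnB BD.sgnB ∘ₗ BD.Δ := by
  apply bar_ext
  intro L
  simp only [LinearMap.comp_apply]
  rw [sgnB_hw, map_zsmul, Δ_hw, lmap_spl, smul_spl]
  refine spl_congr fun X Y h => ?_
  rw [TensorProduct.map_tmul, sgnB_hw, sgnB_hw, ← h, hd_append, pm_add, TensorProduct.tmul_smul,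
    ← TensorProduct.smul_tmul', smul_smul, mul_comm]

theorem zt1 {N P : Type} [AddCommGroup N] [AddCommGroup P] [Module R N] [Module R P] (n : ℤ)
    (x : N) (y : P) : (n • x) ⊗ₜ[R] y = n • (x ⊗ₜ[R] y) :=
  map_zsmul ((TensorProduct.mk R N P).flip y) n x

theorem zt2 {N P : Type} [AddCommGroup N] [AddCommGroup P] [Module R N] [Module R P] (n : ℤ)
    (x : N) (y : P) : x ⊗ₜ[R] (n • y) = n • (x ⊗ₜ[R] y) :=
  map_zsmul (TensorProduct.mk R N P x) n y

theorem sign_aux {N : Type} [AddCommGroup N] (s x y u : ℤ) (hy : y * y = 1) (a b c e : N) :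
    s • a + x • (s * u) • b + (y • x • (s * y) • c + u • y • x • s • e) =
      s • (a + x • c) + s • (u • x • b + y • u • x • e) := by
  simp only [smul_smul, smul_add]
  have h1' : y * (x * (s * y)) = s * x := by linear_combination (s * x) * hy
  have h2 : x * (s * u) = s * (u * x) := by ring
  have h3 : u * (y * (x * s)) = s * (y * (u * x)) := by ring
  simp only [h1', h2, h3]
  abel

theorem dBB_coder : BD.ΔBB ∘ₗ BD.dBB =
    (TensorProduct.map BD.dBB LinearMap.id +
      TensorProduct.map (TensorProduct.map BD.sgnB BD.sgnB) BD.dBB) ∘ₗ BD.ΔBB := by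
  have key : BD.midTw ∘ₗ (TensorProduct.map BD.dBB LinearMap.id +
      TensorProduct.map (TensorProduct.map BD.sgnB BD.sgnB) BD.dBB) =
    (TensorProduct.map BD.dBB LinearMap.id +
      TensorProduct.map (TensorProduct.map BD.sgnB BD.sgnB) BD.dBB) ∘ₗ BD.midTw := by
    apply bbbb_ext
    intro X Y U V
    simp only [LinearMap.comp_apply, LinearMap.add_apply, TensorProduct.map_tmul, BarData.dBB, hc,
      sgnB_hw, LinearMap.id_apply, TensorProduct.add_tmul, TensorProduct.tmul_add,
      zt1, zt2]
    simp only [map_add, map_zsmul]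
    rw [midTw_mem BD _ _ (hw_mem Y) (hw_mem U), midTw_mem BD _ _ (hw_mem Y) (hw_mem U),
      midTw_mem BD _ _ (hw_mem Y) (hw_mem U),
      midTw_mem BD _ _ (dB_hw_mem BD Y) (hw_mem U), midTw_mem BD _ _ (hw_mem Y) (dB_hw_mem BD U)]
    simp only [map_zsmul, TensorProduct.map_tmul, LinearMap.add_apply, LinearMap.id_apply, sgnB_hw,
      TensorProduct.add_tmul, TensorProduct.tmul_add, zt1, zt2]
    simp only [mul_add, add_mul, one_mul, mul_one, pm_add]
    exact sign_aux (N := (A.Bar ⊗[R] A.Bar) ⊗[R] (A.Bar ⊗[R] A.Bar)) _ _ _ _ (pm_self (hd Y)) _ _ _ _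
  rw [BarData.ΔBB, ← LinearMap.comp_assoc (TensorProduct.map BD.Δ BD.Δ), ← key, LinearMap.comp_assoc, LinearMap.comp_assoc]
  congr 1
  rw [BarData.dBB, LinearMap.comp_add, LinearMap.add_comp]
  simp only [← TensorProduct.map_comp]
  rw [dB_coder, sgn_Δ, LinearMap.id_comp, LinearMap.comp_id]

theorem hw_nil_ne_εBB {X U : List (HL A)} (h : X ≠ [] ∨ U ≠ []) : BD.εBB (hc X U) = 0 := by
  have : BD.εBB (hc X U) = BD.εB (hw X) * BD.εB (hw U) := by
    simp [BarData.εBB, hc]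
  rw [this]
  rcases h with h | h <;> simp [εB_hw_ne BD h]

theorem εBB_nil : BD.εBB (hc ([] : List (HL A)) []) = 1 := by
  simp [BarData.εBB, hc, hw_nil, BD.εB_one]

theorem conv_hc {Q N S : Type} [AddCommGroup Q] [AddCommGroup N] [AddCommGroup S]
    [Module R Q] [Module R N] [Module R S]
    (Φ : Q ⊗[R] N →ₗ[R] S) (P : A.Bar ⊗[R] A.Bar →ₗ[R] Q) (G : A.Bar ⊗[R] A.Bar →ₗ[R] N)
    (L M : List (HL A)) :
    Φ (TensorProduct.map P G (BD.ΔBB (hc L M))) =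
      bispl L M (fun X U Y V => Φ (P (hc X U) ⊗ₜ[R] G (hc Y V))) := by
  rw [ΔBB_hc]
  have := lmap_bispl (N := (A.Bar ⊗[R] A.Bar) ⊗[R] (A.Bar ⊗[R] A.Bar)) (P := S)
    (Φ ∘ₗ TensorProduct.map P G) L M (fun X U Y V => hc X U ⊗ₜ[R] hc Y V)
  simp only [LinearMap.comp_apply, TensorProduct.map_tmul] at this
  exact this

theorem bispl_uniq {N : Type} [AddCommGroup N] (c D1 D2 : List (HL A) → List (HL A) → N)
    (K : List (HL A) → List (HL A) → N → N) (h0 : ∀ y y', K [] [] y = K [] [] y')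
    (h1 : ∀ L M, D1 L M = c L M + bispl L M (fun X U Y V => K X U (D1 Y V)))
    (h2 : ∀ L M, D2 L M = c L M + bispl L M (fun X U Y V => K X U (D2 Y V)))
    (L M : List (HL A)) : D1 L M = D2 L M := by
  induction h : L.length + M.length using Nat.strong_induction_on generalizing L M with
  | _ n ih =>
    rw [h1, h2]
    congr 1
    refine bispl_congr fun X U Y V hL hM => ?_
    by_cases hXU : X = [] ∧ U = []
    · rw [hXU.1, hXU.2]; exact h0 _ _
    · rw [ih (Y.length + V.length) _ Y V rfl]
      rw [← h, ← hL, ← hM, List.length_append, List.length_append]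
      rw [← List.length_eq_zero_iff, ← List.length_eq_zero_iff] at hXU
      omega

/-- The convolution operator `G ↦ ∇(ιE ⊗ G)Δ`. -/
def cvl (E : A.Bar ⊗[R] A.Bar →ₗ[R] A.carrier) (G : A.Bar ⊗[R] A.Bar →ₗ[R] A.Bar) :
    A.Bar ⊗[R] A.Bar →ₗ[R] A.Bar :=
  LinearMap.mul' R A.Bar ∘ₗ TensorProduct.map (TensorAlgebra.ι R ∘ₗ E) G ∘ₗ BD.ΔBB

theorem cvl_hc (E : A.Bar ⊗[R] A.Bar →ₗ[R] A.carrier) (G : A.Bar ⊗[R] A.Bar →ₗ[R] A.Bar)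
    (L M : List (HL A)) : cvl BD E G (hc L M) =
      bispl L M (fun X U Y V => TensorAlgebra.ι R (E (hc X U)) * G (hc Y V)) := by
  rw [cvl, LinearMap.comp_apply, LinearMap.comp_apply, conv_hc]
  rfl

/-- unit composed with counit -/
def ηε : A.Bar ⊗[R] A.Bar →ₗ[R] A.Bar := LinearMap.toSpanSingleton R A.Bar 1 ∘ₗ BD.εBB

/-- The fixed point equation characterizing the coalgebra map with projection `E`. -/
def IsSol (E : A.Bar ⊗[R] A.Bar →ₗ[R] A.carrier) (f : A.Bar ⊗[R] A.Bar →ₗ[R] A.Bar) : Prop :=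
  f = ηε BD + cvl BD E f

variable {BD}
variable {E : A.Bar ⊗[R] A.Bar →ₗ[R] A.carrier} {f : A.Bar ⊗[R] A.Bar →ₗ[R] A.Bar}

theorem IsSol.apply_hc (h : IsSol BD E f) (L M : List (HL A)) : f (hc L M) =
    BD.εBB (hc L M) • (1 : A.Bar) +
      bispl L M (fun X U Y V => TensorAlgebra.ι R (E (hc X U)) * f (hc Y V)) := by
  conv_lhs => rw [h]
  rw [LinearMap.add_apply, cvl_hc]
  rfl

theorem IsSol.unique {f' : A.Bar ⊗[R] A.Bar →ₗ[R] A.Bar} (hE : E (hc [] []) = 0)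
    (h : IsSol BD E f) (h' : IsSol BD E f') : f = f' := by
  apply bb_ext
  exact bispl_uniq (fun L M => BD.εBB (hc L M) • (1 : A.Bar)) (fun L M => f (hc L M))
    (fun L M => f' (hc L M)) (fun X U y => TensorAlgebra.ι R (E (hc X U)) * y)
    (by intro y y'; simp [hE]) h.apply_hc h'.apply_hc

theorem mult_isSol (fm : BarMult BD) : IsSol BD (BD.α ∘ₗ fm.f) fm.f := by
  unfold IsSol
  refine LinearMap.ext fun x => ?_
  have h := bar_decomp BD (fm.f x)
  have h1 : BD.εB (fm.f x) = BD.εBB x := LinearMap.congr_fun fm.counit x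
  have h2 : BD.Δ (fm.f x) = TensorProduct.map fm.f fm.f (BD.ΔBB x) :=
    LinearMap.congr_fun fm.coalg x
  rw [h1] at h
  simp only [LinearMap.comp_apply] at h
  rw [h2] at h
  conv_lhs => rw [h]
  rw [LinearMap.add_apply, cvl, LinearMap.comp_apply, LinearMap.comp_apply]
  congr 1
  congr 1
  generalize BD.ΔBB x = y
  rw [← LinearMap.comp_apply (TensorProduct.map (TensorAlgebra.ι R ∘ₗ BD.α) LinearMap.id),
    ← TensorProduct.map_comp, LinearMap.id_comp, LinearMap.comp_assoc]

theorem bb_span : Submodule.span R (Set.range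
    (fun p : List (HL A) × List (HL A) => (hc p.1 p.2 : A.Bar ⊗[R] A.Bar))) = ⊤ := by
  rw [← Submodule.ker_mkQ (Submodule.span R (Set.range
    (fun p : List (HL A) × List (HL A) => (hc p.1 p.2 : A.Bar ⊗[R] A.Bar)))), LinearMap.ker_eq_top]
  apply bb_ext
  intro L M
  rw [LinearMap.zero_apply, Submodule.mkQ_apply, Submodule.Quotient.mk_eq_zero]
  exact Submodule.subset_span ⟨(L, M), rfl⟩

/-- the components of the solution -/
def Fn (BD : BarData A) (E : A.Bar ⊗[R] A.Bar →ₗ[R] A.carrier) :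
    ℕ → (A.Bar ⊗[R] A.Bar →ₗ[R] A.Bar)
  | 0 => ηε BD
  | n + 1 => cvl BD E (Fn BD E n)

theorem Fn_vanish (hE : E (hc [] []) = 0) (n : ℕ) (L M : List (HL A))
    (h : L.length + M.length < n) : Fn BD E n (hc L M) = 0 := by
  induction n generalizing L M with
  | zero => omega
  | succ n ih =>
    rw [Fn, cvl_hc, ← bispl_zero L M]
    refine bispl_congr fun X U Y V hL hM => ?_
    by_cases hXU : X = [] ∧ U = []
    · rw [hXU.1, hXU.2, hE]; simp
    · have : Fn BD E n (hc Y V) = 0 := by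
        apply ih
        rw [← hL, ← hM, List.length_append, List.length_append] at h
        rw [← List.length_eq_zero_iff, ← List.length_eq_zero_iff] at hXU
        omega
      rw [this, mul_zero]

theorem Fn_finite (hE : E (hc [] []) = 0) (x : A.Bar ⊗[R] A.Bar) :
    (Function.support fun n => Fn BD E n x).Finite := by
  have hx : x ∈ Submodule.span R (Set.range
    (fun p : List (HL A) × List (HL A) => (hc p.1 p.2 : A.Bar ⊗[R] A.Bar))) := by
    rw [bb_span]; trivial
  induction hx using Submodule.span_induction with
  | mem x hx =>
    obtain ⟨⟨L, M⟩, rfl⟩ := hx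
    refine (Set.finite_Iic (L.length + M.length)).subset fun n hn => ?_
    by_contra hlt
    exact hn (Fn_vanish hE n L M (by simpa using hlt))
  | zero => simp
  | add x y _ _ hx hy =>
    refine (hx.union hy).subset ?_
    simp only [map_add]
    exact Function.support_add _ _
  | smul r x _ hx =>
    refine hx.subset fun n hn => ?_
    simp only [Function.mem_support, map_smul] at hn ⊢
    exact fun h => hn (by rw [h, smul_zero])

/-- the solution -/
def sol (BD : BarData A) (hE : E (hc [] []) = 0) : A.Bar ⊗[R] A.Bar →ₗ[R] A.Bar where
  toFun x := ∑ᶠ n, Fn BD E n x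
  map_add' x y := by
    simp only [map_add]
    exact finsum_add_distrib (Fn_finite hE x) (Fn_finite hE y)
  map_smul' r x := by
    simp only [map_smul, RingHom.id_apply]
    exact (smul_finsum' r (Fn_finite hE x)).symm

theorem sol_hc (hE : E (hc [] []) = 0) (L M : List (HL A)) (N : ℕ)
    (h : L.length + M.length < N) : sol BD hE (hc L M) =
      (∑ n ∈ Finset.range N, Fn BD E n) (hc L M) := by
  rw [LinearMap.sum_apply]
  refine finsum_eq_sum_of_support_subset _ fun n hn => ?_
  simp only [Finset.coe_range, Set.mem_Iio]
  by_contra hlt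
  exact hn (Fn_vanish hE n L M (by omega))

theorem sol_isSol (hE : E (hc [] []) = 0) : IsSol BD E (sol BD hE) := by
  apply bb_ext
  intro L M
  rw [sol_hc hE L M (L.length + M.length + 1 + 1) (by omega), Finset.sum_range_succ',
    LinearMap.add_apply, LinearMap.add_apply, add_comm]
  congr 1
  have h1 : ∑ n ∈ Finset.range (L.length + M.length + 1), Fn BD E (n + 1) =
      cvl BD E (∑ n ∈ Finset.range (L.length + M.length + 1), Fn BD E n) := by
    apply bb_ext
    intro X Y
    simp only [Fn, cvl, LinearMap.sum_apply, LinearMap.comp_apply]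
    rw [← map_sum]
    congr 1
    generalize BD.ΔBB (hc X Y) = z
    have : ∀ s : Finset ℕ, TensorProduct.map (TensorAlgebra.ι R ∘ₗ E) (∑ n ∈ s, Fn BD E n) =
        ∑ n ∈ s, TensorProduct.map (TensorAlgebra.ι R ∘ₗ E) (Fn BD E n) := by
      intro s
      exact map_sum (TensorProduct.mapBilinear (RingHom.id R) _ _ _ _ (TensorAlgebra.ι R ∘ₗ E)) _ s
    rw [this, LinearMap.sum_apply]
  rw [h1, cvl_hc, cvl_hc]
  refine bispl_congr fun X U Y V hL hM => ?_
  rw [sol_hc hE Y V (L.length + M.length + 1)]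
  rw [← hL, ← hM, List.length_append, List.length_append]
  omega

theorem IsSol.counit (h : IsSol BD E f) (L M : List (HL A)) :
    BD.εB (f (hc L M)) = BD.εBB (hc L M) := by
  rw [h.apply_hc, map_add, map_smul, BD.εB_one, smul_eq_mul, mul_one, lmap_bispl]
  simp only [εB_cons]
  rw [bispl_zero, add_zero]

theorem IsSol.proj (h : IsSol BD E f) (L M : List (HL A)) :
    BD.α (f (hc L M)) = E (hc L M) := by
  rw [h.apply_hc, map_add, map_smul, α_one, smul_zero, zero_add, lmap_bispl]
  simp only [α_cons, h.counit]
  rw [bispl_right]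
  · rw [εBB_nil, one_smul]
  · intro X U Y V hYV
    rw [hw_nil_ne_εBB BD hYV, zero_smul]

theorem map_ff (L M : List (HL A)) : TensorProduct.map f f (BD.ΔBB (hc L M)) =
    bispl L M (fun X U Y V => f (hc X U) ⊗ₜ[R] f (hc Y V)) :=
  conv_hc BD LinearMap.id f f L M

theorem IsSol.coalg (hE : E (hc [] []) = 0) (h : IsSol BD E f) (L M : List (HL A)) :
    BD.Δ (f (hc L M)) = TensorProduct.map f f (BD.ΔBB (hc L M)) := by
  refine bispl_uniq (fun L M => (1 : A.Bar) ⊗ₜ[R] f (hc L M)) (fun L M => BD.Δ (f (hc L M)))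
    (fun L M => TensorProduct.map f f (BD.ΔBB (hc L M)))
    (fun X U y => TensorProduct.map (LinearMap.mulLeft R (TensorAlgebra.ι R (E (hc X U))))
      LinearMap.id y) ?_ ?_ ?_ L M
  · intro y y'
    have : LinearMap.mulLeft R (TensorAlgebra.ι R (E (hc [] []))) = 0 := by
      rw [hE]; ext; simp
    rw [this, TensorProduct.map_zero_left]
    simp
  · intro L M
    have h1 := congrArg BD.Δ (h.apply_hc L M)
    have h2 := congrArg (TensorProduct.mk R A.Bar A.Bar 1) (h.apply_hc L M)
    rw [map_add, map_smul, lmap_bispl] at h1 h2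
    simp only [TensorProduct.mk_apply] at h2
    rw [h1, h2, Δ_one, add_assoc, ← bispl_add]
    simp only [Δ_cons]
  · intro L M
    rw [map_ff]
    have h1 : bispl L M (fun X U Y V => f (hc X U) ⊗ₜ[R] f (hc Y V)) =
      bispl L M (fun X U Y V => (BD.εBB (hc X U) • (1 : A.Bar)) ⊗ₜ[R] f (hc Y V) +
        bispl X U (fun X1 U1 X2 U2 =>
          (TensorAlgebra.ι R (E (hc X1 U1)) * f (hc X2 U2)) ⊗ₜ[R] f (hc Y V))) := by
      refine bispl_congr fun X U Y V _ _ => ?_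
      conv_lhs => rw [h.apply_hc X U]
      rw [TensorProduct.add_tmul]
      congr 1
      exact lmap_bispl ((TensorProduct.mk R A.Bar A.Bar).flip (f (hc Y V))) X U _
    rw [h1, bispl_add, bispl_coassoc L M (fun X1 U1 X2 U2 Y V =>
          (TensorAlgebra.ι R (E (hc X1 U1)) * f (hc X2 U2)) ⊗ₜ[R] f (hc Y V))]
    congr 1
    · rw [bispl_left]
      · rw [εBB_nil, one_smul]
      · intro X U Y V hXU
        rw [hw_nil_ne_εBB BD hXU, zero_smul, TensorProduct.zero_tmul]
    · refine bispl_congr fun X U Y V _ _ => ?_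
      rw [map_ff, lmap_bispl]
      rfl

theorem εBB_dBB (L M : List (HL A)) : BD.εBB (BD.dBB (hc L M)) = 0 := by
  have hd : ∀ x, BD.εB (BD.dB x) = 0 := by
    intro x
    have : BD.εB ∘ₗ BD.dB = 0 := by
      apply bar_ext
      intro L
      simp only [LinearMap.comp_apply, LinearMap.zero_apply]
      induction L with
      | nil => simp [hw_nil, dB_one]
      | cons a L ih =>
        rw [hw_cons, dB_cons BD a.2.2]
        simp only [map_add, map_neg, map_zsmul, εB_cons]
        cases L with
        | nil => simp [hw_nil, Mop_one]
        | cons b L => rw [hw_cons, Mop_cons, εB_cons]; simp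
    exact LinearMap.congr_fun this x
  simp [BarData.εBB, BarData.dBB, hc, hd]

theorem IsTwistingCochain.nil (h : IsTwistingCochain BD E) : E (hc [] []) = 0 := by
  rw [hc, hw_nil, h.unit_left, α_one]

theorem sgnBB_hc (X U : List (HL A)) : TensorProduct.map BD.sgnB BD.sgnB (hc X U) =
    pm (hd X + hd U) • hc X U := by
  rw [hc, TensorProduct.map_tmul, sgnB_hw, sgnB_hw, zt1, zt2, smul_smul, pm_add]

theorem IsTwistingCochain.mem (h : IsTwistingCochain BD E) (X U : List (HL A)) :
    E (hc X U) ∈ A.grading (hd X + hd U + 1) :=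
  h.degree _ _ _ _ (homog_hw X) (homog_hw U)

theorem IsSol.chain (hT : IsTwistingCochain BD E) (h : IsSol BD E f) (L M : List (HL A)) :
    BD.dB (f (hc L M)) = f (BD.dBB (hc L M)) := by
  refine bispl_uniq
    (fun L M => bispl L M (fun X U Y V => TensorAlgebra.ι R (E (BD.dBB (hc X U))) * f (hc Y V)))
    (fun L M => BD.dB (f (hc L M)))
    (fun L M => f (BD.dBB (hc L M)))
    (fun X U y => pm (hd X + hd U) • (TensorAlgebra.ι R (E (hc X U)) * y)) ?_ ?_ ?_ L M
  · intro y y'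
    simp [hT.nil]
  · intro L M
    have h1 := congrArg BD.dB (h.apply_hc L M)
    rw [map_add, map_smul, lmap_bispl, dB_one, smul_zero, zero_add] at h1
    rw [h1]
    have hM : ∀ X U Y V, Mop BD (E (hc X U)) (f (hc Y V)) = bispl Y V (fun Y1 V1 Y2 V2 =>
        TensorAlgebra.ι R (E (hc X U) * E (hc Y1 V1)) * f (hc Y2 V2)) := by
      intro X U Y V
      rw [Mop, LinearMap.comp_apply, LinearMap.comp_apply, h.coalg hT.nil, map_ff, lmap_bispl,
        lmap_bispl]
      refine bispl_congr fun Y1 V1 Y2 V2 _ _ => ?_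
      simp only [TensorProduct.map_tmul, LinearMap.comp_apply, h.proj, LinearMap.mulLeft_apply,
        LinearMap.mul'_apply, LinearMap.id_apply]
    have h2 : ∀ X U Y V, BD.dB (TensorAlgebra.ι R (E (hc X U)) * f (hc Y V)) =
        (- (TensorAlgebra.ι R (A.d (E (hc X U))) * f (hc Y V)) +
        pm (hd X + hd U) • (TensorAlgebra.ι R (E (hc X U)) * BD.dB (f (hc Y V)))) +
        bispl Y V (fun Y1 V1 Y2 V2 => pm (hd X + hd U) • (
          TensorAlgebra.ι R (E (hc X U) * E (hc Y1 V1)) * f (hc Y2 V2))) := by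
      intro X U Y V
      rw [dB_cons BD (hT.mem X U), hM, add_sub_cancel_right]
      congr 1
      exact lmap_bispl ((pm (hd X + hd U)) • (LinearMap.id : A.Bar →ₗ[R] A.Bar)) Y V _
    simp only [h2]
    rw [bispl_add, ← bispl_coassoc L M (fun X U Y1 V1 Y2 V2 => pm (hd X + hd U) • (
          TensorAlgebra.ι R (E (hc X U) * E (hc Y1 V1)) * f (hc Y2 V2))), ← bispl_add, ← bispl_add]
    refine bispl_congr fun X U Y V _ _ => ?_
    have h3 := LinearMap.congr_fun hT.twist (hc X U)
    simp only [LinearMap.comp_apply, LinearMap.add_apply] at h3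
    rw [conv_hc] at h3
    simp only [LinearMap.comp_apply, sgnBB_hc, map_zsmul, LinearMap.mul'_apply] at h3
    have h4 := congrArg (LinearMap.mulRight R (f (hc Y V)) ∘ₗ TensorAlgebra.ι R) h3
    rw [lmap_bispl] at h4
    simp only [LinearMap.comp_apply, LinearMap.mulRight_apply, map_add, smul_mul_assoc,
      map_zsmul] at h4
    rw [← h4]
    abel
  · intro L M
    have h1 : f (BD.dBB (hc L M)) = ηε BD (BD.dBB (hc L M)) + cvl BD E f (BD.dBB (hc L M)) := by
      conv_lhs => rw [h]
      rfl
    have h0 : ηε BD (BD.dBB (hc L M)) = 0 := by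
      rw [ηε, LinearMap.comp_apply, εBB_dBB, map_zero]
    have h2 : BD.ΔBB (BD.dBB (hc L M)) = TensorProduct.map BD.dBB LinearMap.id (BD.ΔBB (hc L M)) +
      TensorProduct.map (TensorProduct.map BD.sgnB BD.sgnB) BD.dBB (BD.ΔBB (hc L M)) :=
      LinearMap.congr_fun (dBB_coder BD) (hc L M)
    rw [h1, h0, zero_add, cvl, LinearMap.comp_apply, LinearMap.comp_apply, h2, map_add, map_add]
    congr 1
    · have := conv_hc BD (LinearMap.mul' R A.Bar ∘ₗ TensorProduct.map (TensorAlgebra.ι R ∘ₗ E) f)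
        BD.dBB LinearMap.id L M
      simp only [LinearMap.comp_apply, TensorProduct.map_tmul, LinearMap.mul'_apply,
        LinearMap.id_apply] at this
      exact this
    · have := conv_hc BD (LinearMap.mul' R A.Bar ∘ₗ TensorProduct.map (TensorAlgebra.ι R ∘ₗ E) f)
        (TensorProduct.map BD.sgnB BD.sgnB) BD.dBB L M
      simp only [LinearMap.comp_apply, TensorProduct.map_tmul, LinearMap.mul'_apply, sgnBB_hc,
        map_zsmul, smul_mul_assoc] at this
      exact this

theorem spl_mem {N : Type} [AddCommGroup N] [Module R N] (S : Submodule R N) (L : List (HL A))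
    (g : List (HL A) → List (HL A) → N) (h : ∀ X Y, X ++ Y = L → g X Y ∈ S) : spl L g ∈ S := by
  rw [spl_eq_sum]
  exact Submodule.sum_mem _ fun i _ => h _ _ (List.take_append_drop i L)

theorem IsSol.graded (hT : IsTwistingCochain BD E) (h : IsSol BD E f) (L M : List (HL A)) :
    f (hc L M) ∈ A.barGrading (hd L + hd M) := by
  induction hn : L.length + M.length using Nat.strong_induction_on generalizing L M with
  | _ n ih =>
    rw [h.apply_hc]
    refine Submodule.add_mem _ ?_ ?_
    · by_cases hLM : L = [] ∧ M = []
      · obtain ⟨rfl, rfl⟩ := hLM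
        refine Submodule.smul_mem _ _ ?_
        have := hw_mem ([] : List (HL A))
        rw [hw_nil] at this
        simpa [hd_nil] using this
      · rw [hw_nil_ne_εBB BD (by tauto), zero_smul]
        exact Submodule.zero_mem _
    · refine spl_mem _ _ _ fun X Y hL => spl_mem _ _ _ fun U V hM => zsmul_mem ?_ _
      beta_reduce
      by_cases hXU : X = [] ∧ U = []
      · rw [hXU.1, hXU.2, hT.nil, map_zero, zero_mul]
        exact Submodule.zero_mem _
      · have h1 := ih (Y.length + V.length) (by
          rw [← hn, ← hL, ← hM, List.length_append, List.length_append]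
          rw [← List.length_eq_zero_iff, ← List.length_eq_zero_iff] at hXU
          omega) Y V rfl
        convert ι_mul_mem (hT.mem X U) h1 using 2
        rw [← hL, ← hM, hd_append, hd_append]
        ring

theorem IsSol.one_mul (hT : IsTwistingCochain BD E) (h : IsSol BD E f) (M : List (HL A)) :
    f (hc [] M) = hw M := by
  induction M with
  | nil =>
    rw [h.apply_hc, εBB_nil, one_smul]
    simp [bispl, spl, hT.nil, hw_nil]
  | cons a M ih =>
    rw [h.apply_hc, hw_nil_ne_εBB BD (by simp), zero_smul, zero_add]
    simp only [bispl, spl, hT.nil, map_zero, zero_mul, smul_zero, zero_add, hd_nil, pm_zero,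
      one_smul]
    rw [spl_left]
    · rw [ih, hw_cons, hc, hw_nil, hT.unit_left, hw_cons, hw_nil, α_cons, BD.εB_one, one_smul]
    · intro Y Z hY
      rw [hc, hw_nil, hT.unit_left, hw_cons, α_cons, εB_hw_ne BD hY, zero_smul, map_zero, zero_mul]

theorem IsSol.mul_one (hT : IsTwistingCochain BD E) (h : IsSol BD E f) (M : List (HL A)) :
    f (hc M []) = hw M := by
  induction M with
  | nil => exact h.one_mul hT []
  | cons a M ih =>
    rw [h.apply_hc, hw_nil_ne_εBB BD (by simp), zero_smul, zero_add]
    simp only [bispl, spl, hT.nil, map_zero, zero_mul, smul_zero, zero_add, hd_nil, pm_zero,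
      one_smul, mul_zero]
    rw [spl_left]
    · rw [ih, hw_cons, hc, hw_nil, hT.unit_right, hw_cons, hw_nil, α_cons, BD.εB_one, one_smul]
    · intro Y Z hY
      rw [hc, hw_nil, hT.unit_right, hw_cons, α_cons, εB_hw_ne BD hY, zero_smul, map_zero, zero_mul]

theorem α_mem {n : ℤ} {x : A.Bar} (hx : x ∈ A.barGrading n) : BD.α x ∈ A.grading (n + 1) := by
  refine barGrading_induction (p := fun x => BD.α x ∈ A.grading (n + 1))
    ?_ ?_ ?_ ?_ hx
  · simp
  · intro x y hx hy; rw [map_add]; exact Submodule.add_mem _ hx hy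
  · intro r x hx; rw [map_smul]; exact Submodule.smul_mem _ _ hx
  · rintro L rfl
    cases L with
    | nil => simp [hw_nil, α_one]
    | cons a L =>
      rw [hw_cons, α_cons]
      by_cases hL : L = []
      · subst hL
        refine Submodule.smul_mem _ _ ?_
        rw [hd_cons, hd_nil, add_zero, sub_add_cancel]
        exact a.2.2
      · rw [εB_hw_ne BD hL, zero_smul]
        exact Submodule.zero_mem _

theorem α_twist (x : A.Bar) : A.d (BD.α x) + BD.α (BD.dB x) =
    LinearMap.mul' R A.carrier (TensorProduct.map (BD.α ∘ₗ BD.sgnB) BD.α (BD.Δ x)) := by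
  have : A.d ∘ₗ BD.α + BD.α ∘ₗ BD.dB = LinearMap.mul' R A.carrier ∘ₗ
      (TensorProduct.map (BD.α ∘ₗ BD.sgnB) BD.α) ∘ₗ BD.Δ := by
    apply bar_ext
    intro L
    simp only [LinearMap.comp_apply, LinearMap.add_apply]
    rw [Δ_hw, lmap_spl, lmap_spl]
    simp only [TensorProduct.map_tmul, LinearMap.comp_apply, sgnB_hw, map_zsmul,
      LinearMap.mul'_apply]
    cases L with
    | nil => simp [hw_nil, α_one, dB_one, spl]
    | cons a L =>
      rw [spl, hw_nil, α_one, smul_zero, zero_mul, zero_add, spl_left]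
      · have hε : BD.εB (BD.dB (hw L)) = 0 := by
          have := εBB_dBB (BD := BD) L []
          simpa [BarData.εBB, BarData.dBB, hc, hw_nil, BD.εB_one, dB_one] using this
        have hα : BD.α (Mop BD a.2 (hw L)) = a.2 * BD.α (hw L) := by
          cases L with
          | nil => simp [hw_nil, Mop_one, α_one]
          | cons b L => simp only [hw_cons, Mop_cons, α_cons, mul_smul_comm]
        rw [hw_cons, dB_cons BD a.2.2, α_cons]
        simp only [map_add, map_neg, map_zsmul, α_cons, hε, hα, hw_cons, hw_nil, BD.εB_one,
          one_smul, zero_smul, smul_zero, hd_cons, hd_nil, add_zero, map_smul, smul_mul_assoc]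
        abel
      · intro Y Z hY
        rw [hw_cons, α_cons, εB_hw_ne BD hY, zero_smul, smul_zero, zero_mul]
  exact LinearMap.congr_fun this x

theorem mult_twisting (fm : BarMult BD) : IsTwistingCochain BD (BD.α ∘ₗ fm.f) where
  degree l m ds es hl hm := α_mem (fm.graded l m ds es hl hm)
  unit_left b := by rw [LinearMap.comp_apply, fm.one_mul]
  unit_right b := by rw [LinearMap.comp_apply, fm.mul_one]
  twist := by
    have hs : BD.sgnB ∘ₗ fm.f = fm.f ∘ₗ TensorProduct.map BD.sgnB BD.sgnB := by
      apply bb_ext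
      intro L M
      rw [LinearMap.comp_apply, LinearMap.comp_apply, sgnBB_hc, map_zsmul]
      exact sgnB_mem BD (fm.graded _ _ _ _ (homog_hw L) (homog_hw M))
    refine LinearMap.ext fun x => ?_
    have h1 : BD.dB (fm.f x) = fm.f (BD.dBB x) := LinearMap.congr_fun fm.chain x
    have h2 : BD.Δ (fm.f x) = TensorProduct.map fm.f fm.f (BD.ΔBB x) :=
      LinearMap.congr_fun fm.coalg x
    have h3 := α_twist (BD := BD) (fm.f x)
    rw [h1, h2] at h3
    simp only [LinearMap.comp_apply, LinearMap.add_apply]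
    rw [h3]
    congr 1
    generalize BD.ΔBB x = y
    rw [← LinearMap.comp_apply (TensorProduct.map (BD.α ∘ₗ BD.sgnB) BD.α),
      ← TensorProduct.map_comp, LinearMap.comp_assoc, LinearMap.comp_assoc, hs]

theorem exists_mult (hT : IsTwistingCochain BD E) : ∃ fm : BarMult BD, BD.α ∘ₗ fm.f = E := by
  have h := sol_isSol (BD := BD) hT.nil
  generalize sol BD hT.nil = f at h
  refine ⟨⟨f, ?_, ?_, ?_, ?_, ?_, ?_⟩, ?_⟩
  · intro b
    have : f ∘ₗ TensorProduct.mk R A.Bar A.Bar 1 = LinearMap.id := by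
      apply bar_ext
      intro M
      rw [← hw_nil]
      exact h.one_mul hT M
    exact LinearMap.congr_fun this b
  · intro b
    have : f ∘ₗ (TensorProduct.mk R A.Bar A.Bar).flip 1 = LinearMap.id := by
      apply bar_ext
      intro M
      rw [← hw_nil]
      exact h.mul_one hT M
    exact LinearMap.congr_fun this b
  · intro l m ds es hl hm
    obtain ⟨L, rfl, rfl⟩ := homog_exists hl
    obtain ⟨M, rfl, rfl⟩ := homog_exists hm
    exact h.graded hT L M
  · exact bb_ext fun L M => h.chain hT L M
  · exact bb_ext fun L M => h.counit L M
  · exact bb_ext fun L M => h.coalg hT.nil L M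
  · exact bb_ext fun L M => h.proj L M

end Helpers

/-- For an augmented unital associative dg algebra `A` over `R`,
multiplications on the unnormalized bar construction `BA` (morphisms of dg coalgebras
`BA ⊗ BA → BA` with the counit element `𝟙` as two-sided unit, associativity not
required) correspond bijectively to twisting cochains `E : BA ⊗ BA → A`:
(1) for every such multiplication `f`, the map `E = α ∘ f` is a twisting cochain,
i.e. `E` has degree one, satisfies `d(E) = E ∪ E` and `E(𝟙,-) = E(-,𝟙) = α`;
(2) a multiplication is uniquely determined by its twisting cochain; and
(3) every twisting cochain arises as `α ∘ f` for a (unique such) multiplication `f`. -/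
theorem barMult_twistingCochain_correspondence {R : Type} [CommRing R]
    (A : DGAlgebra R) (BD : BarData A) :
    (∀ fm : BarMult BD, IsTwistingCochain BD (BD.α ∘ₗ fm.f)) ∧
    (∀ fm₁ fm₂ : BarMult BD, BD.α ∘ₗ fm₁.f = BD.α ∘ₗ fm₂.f → fm₁.f = fm₂.f) ∧
    (∀ E : A.Bar ⊗[R] A.Bar →ₗ[R] A.carrier, IsTwistingCochain BD E →
      ∃ fm : BarMult BD, BD.α ∘ₗ fm.f = E) := by
  refine ⟨fun fm => mult_twisting fm, fun fm₁ fm₂ h => ?_, fun E hE => exists_mult hE⟩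
  have h2 := mult_isSol fm₂
  rw [← h] at h2
  exact IsSol.unique (mult_twisting fm₁).nil (mult_isSol fm₁) h2
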